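/- arXiv:2601.08407 — 2 statements merged into one kernel-verified Lean document; each statement's English description precedes it below -/
import Mathlib

section
/- Let X be a connected compact metric space and f : X → X a continuous map whose chain recurrent set CR(f) is totally disconnected. Then every point of X is a lower semicontinuity point of the ω-limit set map ω_f if and only if f is chain continuous at every point of X. -/
open Filter Topology

variable {X : Type*} [MetricSpace X]

/-- The ω-limit set of `x` under `f`: points `y` with `f^[φ j] x → y` for some
strictly increasing sequence `φ`. -/
def omegaLimitPt (f : X → X) (x : X) : Set X :=
  {y | ∃ φ : ℕ → ℕ, StrictMono φ ∧ Tendsto (fun j => f^[φ j] x) atTop (𝓝 y)}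

/-- The set `Ω_f(x)`: points `y` such that there are `x_j → x` and a strictly
increasing sequence `φ` with `f^[φ j] (x_j) → y`. -/
def bigOmega (f : X → X) (x : X) : Set X :=
  {y | ∃ (xs : ℕ → X) (φ : ℕ → ℕ), StrictMono φ ∧
    Tendsto xs atTop (𝓝 x) ∧ Tendsto (fun j => f^[φ j] (xs j)) atTop (𝓝 y)}

/-- `x` is a shadowable point for `f`. -/
def ShadowablePoint (f : X → X) (x : X) : Prop :=
  ∀ ε > 0, ∃ δ > 0, ∀ xs : ℕ → X, (∀ i, dist (f (xs i)) (xs (i + 1)) ≤ δ) →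
    xs 0 = x → ∃ y, ∀ i, dist (xs i) (f^[i] y) ≤ ε

/-- `x` is an upper semicontinuity point of the ω-limit set map. -/
def USCPoint (f : X → X) (x : X) : Prop :=
  ∀ U : Set X, IsOpen U → omegaLimitPt f x ⊆ U →
    ∃ δ > 0, ∀ y, dist x y ≤ δ → omegaLimitPt f y ⊆ U

/-- `x` is a lower semicontinuity point of the ω-limit set map. -/
def LSCPoint (f : X → X) (x : X) : Prop :=
  ∀ U : Set X, IsOpen U → (omegaLimitPt f x ∩ U).Nonempty →
    ∃ δ > 0, ∀ y, dist x y ≤ δ → (omegaLimitPt f y ∩ U).Nonempty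

/-- `(c i)_{i=0}^k` is a `δ`-chain of `f` (with `k ≥ 1`). -/
def IsDeltaChain (f : X → X) (δ : ℝ) (c : ℕ → X) (k : ℕ) : Prop :=
  1 ≤ k ∧ ∀ i < k, dist (f (c i)) (c (i + 1)) ≤ δ

/-- `y → z`: for every `δ > 0` there is a `δ`-chain of `f` from `y` to `z`. -/
def ChainReach (f : X → X) (y z : X) : Prop :=
  ∀ δ > 0, ∃ (c : ℕ → X) (k : ℕ), IsDeltaChain f δ c k ∧ c 0 = y ∧ c k = z

/-- A set `S` is chain stable: `y ∈ S` and `y → z` imply `z ∈ S`. -/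
def ChainStable (f : X → X) (S : Set X) : Prop :=
  ∀ y ∈ S, ∀ z, ChainReach f y z → z ∈ S

/-- The set `ω_f*(x)`: points reachable from `x` by arbitrarily fine and
arbitrarily long `δ`-chains. -/
def omegaStar (f : X → X) (x : X) : Set X :=
  {y | ∀ δ > 0, ∀ l : ℕ, 1 ≤ l → ∃ (c : ℕ → X) (k : ℕ),
    l ≤ k ∧ IsDeltaChain f δ c k ∧ c 0 = x ∧ c k = y}

/-- The chain component of a point `p`. -/
def chainComponent (f : X → X) (p : X) : Set X :=
  {q | ChainReach f p q ∧ ChainReach f q p}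

/-- `f` is chain continuous at `x`. -/
def ChainContinuousAt (f : X → X) (x : X) : Prop :=
  ∀ ε > 0, ∃ δ > 0, ∀ xs : ℕ → X, (∀ i, dist (f (xs i)) (xs (i + 1)) ≤ δ) →
    xs 0 = x → ∀ i, dist (xs i) (f^[i] x) ≤ ε

/-- The chain recurrent set `CR(f)`. -/
def chainRecurrent (f : X → X) : Set X := {x | ChainReach f x x}

/-- `x` is a regularly recurrent point for `f`. -/
def RegularlyRecurrent (f : X → X) (x : X) : Prop :=
  ∀ ε > 0, ∃ k : ℕ, 1 ≤ k ∧ ∀ j : ℕ, dist x (f^[j * k] x) ≤ ε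

/-- `M` is a minimal set for `f`. -/
def IsMinimalSet (f : X → X) (M : Set X) : Prop :=
  M.Nonempty ∧ IsClosed M ∧ f '' M ⊆ M ∧ ∀ y ∈ M, omegaLimitPt f y = M

theorem antitone_range_iterate {Y : Type*} (f : Y → Y) :
    Antitone fun n : ℕ => Set.range f^[n] := by
  refine antitone_nat_of_succ_le fun n => ?_
  rintro _ ⟨x, rfl⟩
  exact ⟨f x, (Function.iterate_succ_apply f n x).symm⟩

/-- The points that can be reached from `y` by a chain of `f` of length at least one all of whose
jumps are smaller than `δ`. -/
def chainSet (f : X → X) (δ : ℝ) (y : X) : Set X :=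
  {z | Relation.TransGen (fun a b => dist (f a) b < δ) y z}

theorem isOpen_chainSet (f : X → X) (δ : ℝ) (y : X) : IsOpen (chainSet f δ y) := by
  rw [isOpen_iff_mem_nhds]
  intro z hz
  obtain ⟨b, hb, hbz⟩ := Relation.TransGen.tail'_iff.1 hz
  have h : ∀ᶠ w in 𝓝 z, dist (f b) w < δ :=
    (continuous_const.dist continuous_id).continuousAt.eventually_lt_const hbz
  filter_upwards [h] with w hw
  exact Relation.TransGen.tail' hb hw

theorem mem_chainSet_of_mem_closure {f : X → X} (hf : Continuous f) {δ : ℝ} {y z w : X}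
    (hz : z ∈ closure (chainSet f δ y)) (hw : dist (f z) w < δ) : w ∈ chainSet f δ y := by
  have h : ∀ᶠ z' in 𝓝 z, dist (f z') w < δ :=
    (hf.dist continuous_const).continuousAt.eventually_lt_const hw
  obtain ⟨z', hz', hmem⟩ := mem_closure_iff_nhds.1 hz _ h
  exact Relation.TransGen.tail hmem hz'

theorem iterate_mem_chainSet {f : X → X} {δ : ℝ} (hδ : 0 < δ) {y x : X} {m n : ℕ}
    (hm : f^[m] x ∈ chainSet f δ y) (hmn : m ≤ n) : f^[n] x ∈ chainSet f δ y := by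
  induction n, hmn using Nat.le_induction with
  | base => exact hm
  | succ n _ ih =>
    refine Relation.TransGen.tail ih ?_
    rwa [Function.iterate_succ_apply', dist_self]

theorem chainReach_of_forall_mem_chainSet {f : X → X} {y z : X}
    (h : ∀ δ > 0, z ∈ chainSet f δ y) : ChainReach f y z := by
  intro δ hδ
  have hz : Relation.TransGen (fun a b => dist (f a) b < δ) y z := h δ hδ
  clear h
  induction hz using Relation.TransGen.head_induction_on with
  | @single a hab =>
    refine ⟨fun i => Nat.casesOn i a fun _ => z, 1, ⟨le_rfl, fun i hi => ?_⟩, rfl, rfl⟩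
    obtain rfl : i = 0 := by omega
    exact hab.le
  | @head a b hab _ ih =>
    obtain ⟨c, k, ⟨-, hc⟩, rfl, rfl⟩ := ih
    refine ⟨fun i => Nat.casesOn i a c, k + 1, ⟨by omega, fun i hi => ?_⟩, rfl, rfl⟩
    cases i with
    | zero => exact hab.le
    | succ i => exact hc i (by omega)

theorem omegaLimitPt_nonempty [CompactSpace X] (f : X → X) (x : X) :
    (omegaLimitPt f x).Nonempty := by
  obtain ⟨a, φ, hφ, ha⟩ := CompactSpace.tendsto_subseq fun n => f^[n] x
  exact ⟨a, φ, hφ, ha⟩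

theorem exists_iterate_mem_of_omegaLimitPt {f : X → X} {x z : X} (hz : z ∈ omegaLimitPt f x)
    {U : Set X} (hU : U ∈ 𝓝 z) (N : ℕ) : ∃ n ≥ N, f^[n] x ∈ U := by
  obtain ⟨φ, hφ, hlim⟩ := hz
  obtain ⟨j, hj, hjN⟩ := ((hlim.eventually hU).and (eventually_ge_atTop N)).exists
  exact ⟨φ j, hjN.trans (hφ.id_le j), hj⟩

theorem omegaLimitPt_subset_of_isClosed {f : X → X} {x : X} {C : Set X} (hC : IsClosed C) {N : ℕ}
    (h : ∀ n ≥ N, f^[n] x ∈ C) : omegaLimitPt f x ⊆ C := by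
  rintro z ⟨φ, hφ, hlim⟩
  refine hC.mem_of_tendsto hlim ?_
  filter_upwards [eventually_ge_atTop N] with j hj
  exact h _ (hj.trans (hφ.id_le j))

theorem mem_chainSet_of_mem_omegaLimitPt {f : X → X} (hf : Continuous f) {δ : ℝ} (hδ : 0 < δ)
    {x y z : X} (hz : z ∈ omegaLimitPt f x) (hzW : z ∈ closure (chainSet f δ y)) :
    z ∈ chainSet f δ y := by
  have hfz : f z ∈ chainSet f δ y := mem_chainSet_of_mem_closure hf hzW (by rwa [dist_self])
  obtain ⟨m, -, hm⟩ := exists_iterate_mem_of_omegaLimitPt hz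
    (hf.continuousAt.preimage_mem_nhds ((isOpen_chainSet f δ y).mem_nhds hfz)) 0
  have hm' : f^[m + 1] x ∈ chainSet f δ y := by rwa [Function.iterate_succ_apply']
  obtain ⟨n, hn, hnz⟩ := exists_iterate_mem_of_omegaLimitPt hz (Metric.ball_mem_nhds z hδ) (m + 2)
  obtain ⟨k, rfl⟩ : ∃ k, n = k + 1 := ⟨n - 1, by omega⟩
  refine Relation.TransGen.tail (iterate_mem_chainSet hδ hm' (by omega : m + 1 ≤ k)) ?_
  rw [← Function.iterate_succ_apply' f k x]
  exact Metric.mem_ball.1 hnz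

theorem isOpen_setOf_omegaLimitPt_inter {f : X → X} (h : ∀ x, LSCPoint f x) {U : Set X}
    (hU : IsOpen U) : IsOpen {x | (omegaLimitPt f x ∩ U).Nonempty} := by
  rw [Metric.isOpen_iff]
  intro x hx
  obtain ⟨δ, hδ, hy⟩ := h x U hU hx
  exact ⟨δ, hδ, fun y hxy => hy y (by rw [dist_comm]; exact (Metric.mem_ball.1 hxy).le)⟩

theorem exists_iterate_mem_chainSet [CompactSpace X] [PreconnectedSpace X] {f : X → X}
    (hf : Continuous f) (h : ∀ x, LSCPoint f x) {δ : ℝ} (hδ : 0 < δ) (x y : X) :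
    ∃ n, f^[n] x ∈ chainSet f δ y := by
  set W := chainSet f δ y
  have hWo : IsOpen W := isOpen_chainSet f δ y
  have omega_subset : ∀ {u m}, f^[m] u ∈ W → omegaLimitPt f u ⊆ closure W := fun hm =>
    omegaLimitPt_subset_of_isClosed isClosed_closure fun _ hn =>
      subset_closure (iterate_mem_chainSet hδ hm hn)
  have exists_iterate : ∀ {u}, (omegaLimitPt f u ∩ W).Nonempty → ∃ n, f^[n] u ∈ W := by
    rintro u ⟨z, hz, hzW⟩
    obtain ⟨m, -, hm⟩ := exists_iterate_mem_of_omegaLimitPt hz (hWo.mem_nhds hzW) 0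
    exact ⟨m, hm⟩
  have meets : ∀ {u m}, f^[m] u ∈ W → (omegaLimitPt f u ∩ W).Nonempty := by
    intro u m hm
    obtain ⟨z, hz⟩ := omegaLimitPt_nonempty f u
    exact ⟨z, hz, mem_chainSet_of_mem_omegaLimitPt hf hδ hz (omega_subset hm hz)⟩
  by_contra hx
  obtain ⟨u, huA, z, hz, hzW⟩ := nonempty_inter
    (isOpen_setOf_omegaLimitPt_inter h hWo)
    (isOpen_setOf_omegaLimitPt_inter h (isClosed_closure (s := W)).isOpen_compl)
    (by
      refine Set.eq_univ_of_forall fun u => ?_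
      obtain ⟨z, hz⟩ := omegaLimitPt_nonempty f u
      by_cases hzW : z ∈ closure W
      · exact Or.inl ⟨z, hz, mem_chainSet_of_mem_omegaLimitPt hf hδ hz hzW⟩
      · exact Or.inr ⟨z, hz, hzW⟩)
    ⟨y, meets (m := 1) (Relation.TransGen.single (by simpa using hδ))⟩
    (by
      obtain ⟨z, hz⟩ := omegaLimitPt_nonempty f x
      refine ⟨x, z, hz, fun hzW => hx (exists_iterate ?_)⟩
      exact ⟨z, hz, mem_chainSet_of_mem_omegaLimitPt hf hδ hz hzW⟩)
  obtain ⟨m, hm⟩ := exists_iterate huA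
  exact hzW (omega_subset hm hz)

theorem iInter_range_iterate_subset_chainRecurrent [CompactSpace X] [PreconnectedSpace X]
    {f : X → X} (hf : Continuous f) (h : ∀ x, LSCPoint f x) :
    ⋂ n : ℕ, Set.range f^[n] ⊆ chainRecurrent f := by
  refine fun y hy => chainReach_of_forall_mem_chainSet fun δ hδ => ?_
  obtain ⟨N, hN⟩ := isCompact_univ.elim_directed_cover
    (fun n : ℕ => f^[n] ⁻¹' chainSet f δ y)
    (fun n => (isOpen_chainSet f δ y).preimage (hf.iterate n))
    (fun x _ => Set.mem_iUnion.2 (exists_iterate_mem_chainSet hf h hδ x y))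
    (Monotone.directed_le fun _ _ hmn _ hx => iterate_mem_chainSet hδ hx hmn)
  obtain ⟨x, rfl⟩ := Set.mem_iInter.1 hy N
  exact hN (Set.mem_univ x)

theorem isPreconnected_iInter_of_directed {ι Y : Type*} [TopologicalSpace Y] [T2Space Y]
    [NormalSpace Y] [Nonempty ι] {K : ι → Set Y} (hK : Directed (· ⊇ ·) K)
    (hc : ∀ i, IsCompact (K i)) (hp : ∀ i, IsPreconnected (K i)) : IsPreconnected (⋂ i, K i) := by
  have hcl : IsClosed (⋂ i, K i) := isClosed_iInter fun i => (hc i).isClosed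
  rw [isPreconnected_iff_subset_of_fully_disjoint_closed hcl]
  intro u v hu hv huv hd
  obtain ⟨U, V, hU, hV, huU, hvV, hUV⟩ := normal_separation hu hv hd
  obtain ⟨i, hi⟩ := exists_subset_nhds_of_isCompact hK hc fun x hx =>
    (hU.union hV).mem_nhds (Set.union_subset_union huU hvV (huv hx))
  rcases (hp i).subset_or_subset hU hV hUV hi with h | h
  · left
    intro x hx
    exact (huv hx).resolve_right fun hxv =>
      Set.disjoint_left.1 hUV (h (Set.mem_iInter.1 hx i)) (hvV hxv)
  · right
    intro x hx
    exact (huv hx).resolve_left fun hxu =>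
      Set.disjoint_left.1 hUV (huU hxu) (h (Set.mem_iInter.1 hx i))

theorem exists_dist_iterate_le [CompactSpace X] {f : X → X} (hf : Continuous f) (N : ℕ)
    {ε : ℝ} (hε : 0 < ε) : ∃ δ > 0, ∀ xs : ℕ → X, (∀ i, dist (f (xs i)) (xs (i + 1)) ≤ δ) →
      ∀ i ≤ N, ∀ n, dist (xs (n + i)) (f^[i] (xs n)) ≤ ε := by
  induction N generalizing ε with
  | zero =>
    refine ⟨1, one_pos, fun xs _ i hi n => ?_⟩
    obtain rfl : i = 0 := by omega
    simpa using hε.le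
  | succ N ih =>
    obtain ⟨η, hη, hfη⟩ := Metric.uniformContinuous_iff.1
      (CompactSpace.uniformContinuous_of_continuous hf) (ε / 2) (by positivity)
    obtain ⟨δ, hδ, h⟩ := ih (ε := min (η / 2) ε) (by positivity)
    refine ⟨min δ (ε / 2), by positivity, fun xs hxs i hi n => ?_⟩
    have hN := h xs fun i => (hxs i).trans (min_le_left _ _)
    rcases Nat.lt_or_ge N i with hNi | hNi
    · obtain rfl : i = N + 1 := by omega
      have h1 : dist (xs (n + N)) (f^[N] (xs n)) < η :=
        ((hN N le_rfl n).trans (min_le_left _ _)).trans_lt (by linarith)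
      have h2 := hfη h1
      have h3 := (hxs (n + N)).trans (min_le_right _ _)
      rw [Function.iterate_succ_apply', ← add_assoc]
      have h4 := dist_triangle_left (xs (n + N + 1)) (f (f^[N] (xs n))) (f (xs (n + N)))
      linarith
    · exact (hN i hNi n).trans (min_le_right _ _)

theorem chainContinuousAt_of_subsingleton_iInter_range [CompactSpace X] {f : X → X}
    (hf : Continuous f) (h : (⋂ n : ℕ, Set.range f^[n]).Subsingleton) (x : X) :
    ChainContinuousAt f x := by
  have hc : ∀ n : ℕ, IsCompact (Set.range f^[n]) := fun n => isCompact_range (hf.iterate n)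
  have hdir : Directed (· ⊇ ·) fun n : ℕ => Set.range f^[n] :=
    (antitone_range_iterate f).directed_ge
  obtain ⟨p, hp⟩ := IsCompact.nonempty_iInter_of_directed_nonempty_isCompact_isClosed
    (fun n : ℕ => Set.range f^[n]) hdir (fun n => ⟨_, x, rfl⟩) hc fun n => (hc n).isClosed
  intro ε hε
  obtain ⟨N, hN⟩ := exists_subset_nhds_of_isCompact hdir hc (U := Metric.ball p (ε / 4))
    fun q hq => by rw [h hq hp]; exact Metric.ball_mem_nhds p (by positivity)
  obtain ⟨δ, hδ, hxs⟩ := exists_dist_iterate_le hf N (ε := ε / 4) (by positivity)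
  refine ⟨δ, hδ, fun xs hchain h0 i => ?_⟩
  rcases le_total i N with hi | hi
  · have := hxs xs hchain i hi 0
    rw [zero_add, h0] at this
    linarith
  · obtain ⟨k, rfl⟩ := Nat.exists_eq_add_of_le' hi
    have h1 := hxs xs hchain N le_rfl k
    have h2 : dist (f^[N] (xs k)) p < ε / 4 := hN ⟨xs k, rfl⟩
    have h3 : dist (f^[k + N] x) p < ε / 4 := hN (antitone_range_iterate f hi ⟨x, rfl⟩)
    have h4 := dist_triangle (xs (k + N)) (f^[N] (xs k)) (f^[k + N] x)
    have h5 := dist_triangle_right (f^[N] (xs k)) (f^[k + N] x) p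
    linarith

theorem ChainContinuousAt.lscPoint [CompactSpace X] {f : X → X} (hf : Continuous f) {x : X}
    (h : ChainContinuousAt f x) : LSCPoint f x := by
  rintro U hU ⟨z, hz, hzU⟩
  obtain ⟨ε, hε, hεU⟩ := Metric.isOpen_iff.1 hU z hzU
  obtain ⟨δ, hδ, hchain⟩ := h (ε / 3) (by positivity)
  obtain ⟨η, hη, hfη⟩ := Metric.continuousAt_iff.1 (hf.continuousAt (x := x)) δ hδ
  refine ⟨η / 2, by positivity, fun y hxy => ?_⟩
  have hfxy : dist (f x) (f y) ≤ δ := by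
    rw [dist_comm]
    exact (hfη (by rw [dist_comm]; linarith)).le
  have close : ∀ n, dist (f^[n + 1] y) (f^[n + 1] x) ≤ ε / 3 := by
    intro n
    refine hchain (fun i => Nat.casesOn i x fun j => f^[j + 1] y) (fun i => ?_) rfl (n + 1)
    cases i with
    | zero => exact hfxy
    | succ i =>
      change dist (f (f^[i + 1] y)) (f^[i + 2] y) ≤ δ
      rw [← Function.iterate_succ_apply' f (i + 1), dist_self]
      exact hδ.le
  obtain ⟨φ, hφ, hlim⟩ := hz
  obtain ⟨w, ψ, hψ, hw⟩ := CompactSpace.tendsto_subseq fun j => f^[φ j] y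
  refine ⟨w, ⟨φ ∘ ψ, hφ.comp hψ, hw⟩, hεU ?_⟩
  have hwz : dist w z ≤ ε / 3 := by
    refine le_of_tendsto (hw.dist (hlim.comp hψ.tendsto_atTop)) ?_
    filter_upwards [eventually_ge_atTop 1] with j hj
    obtain ⟨k, hk⟩ : ∃ k, φ (ψ j) = k + 1 :=
      Nat.exists_eq_add_of_le' (hj.trans ((hψ.id_le j).trans (hφ.id_le _)))
    simpa only [Function.comp_apply, hk] using close k
  exact Metric.mem_ball.2 (by linarith)

theorem stmt17 [CompactSpace X] [ConnectedSpace X] (f : X → X) (hf : Continuous f)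
    (hcr : IsTotallyDisconnected (chainRecurrent f)) :
    (∀ x : X, LSCPoint f x) ↔ (∀ x : X, ChainContinuousAt f x) := by
  refine ⟨fun h => ?_, fun h x => (h x).lscPoint hf⟩
  refine chainContinuousAt_of_subsingleton_iInter_range hf ?_
  refine hcr _ (iInter_range_iterate_subset_chainRecurrent hf h) ?_
  exact isPreconnected_iInter_of_directed (antitone_range_iterate f).directed_ge
    (fun n => isCompact_range (hf.iterate n)) fun n => isPreconnected_range (hf.iterate n)
end

section
/- Let X be a compact metric space and f : X → X a continuous map. If every point of X is an upper semicontinuity point of the ω-limit set map ω_f, then every point of X is a lower semicontinuity point of ω_f. -/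
open Filter Topology

variable {X : Type*} [MetricSpace X]

theorem iterate_mem_omegaLimitPt {f : X → X} (hf : Continuous f) {x y : X}
    (hy : y ∈ omegaLimitPt f x) (k : ℕ) : f^[k] y ∈ omegaLimitPt f x := by
  obtain ⟨φ, hφ, h⟩ := hy
  refine ⟨fun j => k + φ j, hφ.const_add k, ?_⟩
  simpa only [Function.iterate_add_apply, Function.comp_def] using ((hf.iterate k).tendsto y).comp h

theorem omegaLimitPt_subset_iterate (f : X → X) (x : X) (n : ℕ) :
    omegaLimitPt f x ⊆ omegaLimitPt f (f^[n] x) := by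
  rintro y ⟨φ, hφ, h⟩
  have hn : ∀ j, n ≤ φ (j + n) := fun j => (Nat.le_add_left n j).trans (hφ.id_le _)
  refine ⟨fun j => φ (j + n) - n, fun a b hab => ?_, ?_⟩
  · have := hφ (Nat.add_lt_add_right hab n)
    have := hn a
    dsimp only
    omega
  · simpa only [Function.comp_def, ← Function.iterate_add_apply, Nat.sub_add_cancel (hn _)]
      using h.comp (tendsto_add_atTop_nat n)

/-- Upper semicontinuity at a point `w` of `ω_f(x)` forces `ω_f(x) ⊆ ω_f(w)`. -/
theorem omegaLimitPt_subset_of_mem {f : X → X} {x w : X} (husc : USCPoint f w)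
    (hw : w ∈ omegaLimitPt f x) : omegaLimitPt f x ⊆ omegaLimitPt f w := by
  intro z hz
  by_contra hzw
  obtain ⟨δ, hδ, h⟩ := husc {z}ᶜ isOpen_compl_singleton
    (Set.subset_compl_singleton_iff.2 hzw)
  obtain ⟨φ, -, hlim⟩ := hw
  obtain ⟨j, hj⟩ := (hlim.eventually (Metric.ball_mem_nhds w hδ)).exists
  exact h (f^[φ j] x) (Metric.mem_ball'.1 hj).le (omegaLimitPt_subset_iterate f x _ hz) rfl

theorem stmt19 [CompactSpace X] (f : X → X) (hf : Continuous f)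
    (husc : ∀ x : X, USCPoint f x) :
    ∀ x : X, LSCPoint f x := by
  rintro x U hU ⟨z, hzx, hzU⟩
  obtain ⟨δ, hδ, h⟩ := husc x (⋃ k, f^[k] ⁻¹' U)
    (isOpen_iUnion fun k => hU.preimage (hf.iterate k)) fun w hw => by
      obtain ⟨φ, -, hlim⟩ := omegaLimitPt_subset_of_mem (husc w) hw hzx
      obtain ⟨j, hj⟩ := (hlim.eventually (hU.mem_nhds hzU)).exists
      exact Set.mem_iUnion.2 ⟨φ j, hj⟩
  refine ⟨δ, hδ, fun y hy => ?_⟩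
  obtain ⟨w, hw⟩ := omegaLimitPt_nonempty f y
  obtain ⟨k, hk⟩ := Set.mem_iUnion.1 (h y hy hw)
  exact ⟨f^[k] w, iterate_mem_omegaLimitPt hf hw k, hk⟩
end
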